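/- arXiv:1609.04312 — 4 statements merged into one kernel-verified Lean document; each statement's English description precedes it below -/
import Mathlib

section
/- For every n ≥ 1, the uniform distribution is the unique stationary distribution of the top-to-random-with-standardisation chain on S_n: (i) ∑_{σ∈S_n} (1/n!)·K_n(σ,τ) = 1/n! for every τ ∈ S_n; and (ii) if π : S_n → ℝ satisfies π(σ) ≥ 0 for all σ, ∑_{σ} π(σ) = 1, and ∑_{σ} π(σ)·K_n(σ,τ) = π(τ) for every τ, then π(σ) = 1/n! for all σ. -/
open scoped Classical

noncomputable section

/-- The standardisation (rank function) of a word `w = (w 0, …, w (m-1))` of distinct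
letters from a linear order: position `a` is sent to the number of positions carrying a
smaller letter (so, `0`-indexed ranks). -/
def std {m : ℕ} {α : Type*} [LinearOrder α] (w : Fin m → α) : Fin m → Fin m :=
  fun a =>
    ⟨(Finset.univ.filter (fun b => w b < w a)).card, by
      have ha : a ∉ Finset.univ.filter (fun b => w b < w a) := by simp
      have h := Finset.card_lt_card
        ((Finset.ssubset_iff_of_subset (Finset.filter_subset _ _)).2
          ⟨a, Finset.mem_univ a, ha⟩)
      simpa using h⟩

/-- `subMatch n r σ τ` says: the subsequence of the word `(τ 0, …, τ (n-1))` consisting of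
the entries with values `≥ r` (`0`-indexed; these are the values `{r+1,…,n}` in `1`-indexed
notation) has the same standardisation as the word `(σ r, …, σ (n-1))`.
Here `g` is the (unique) strictly increasing enumeration of the relevant positions. -/
def subMatch (n r : ℕ) (σ τ : Equiv.Perm (Fin n)) : Prop :=
  ∃ g : Fin (n - r) → Fin n, StrictMono g ∧
    (∀ p : Fin n, (∃ a, g a = p) ↔ r ≤ (τ p : ℕ)) ∧
    std (fun a => τ (g a)) =
      std (fun a : Fin (n - r) => σ ⟨r + (a : ℕ), by have := a.isLt; omega⟩)

/-- The top-to-random-with-standardisation transition matrix on `S_n`. -/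
def Ktr (n : ℕ) : Matrix (Equiv.Perm (Fin n)) (Equiv.Perm (Fin n)) ℝ :=
  Matrix.of fun σ τ => if subMatch n 1 σ τ then 1 / (n : ℝ) else 0

/-- The binomial-top-to-random-with-standardisation transition matrix on `S_n`,
with parameter `q`. -/
def Kq (n : ℕ) (q : ℝ) : Matrix (Equiv.Perm (Fin n)) (Equiv.Perm (Fin n)) ℝ :=
  Matrix.of fun σ τ =>
    ∑ r ∈ Finset.range (n + 1),
      ((1 - q) ^ r * q ^ (n - r) / (r.factorial : ℝ)) *
        (if subMatch n r σ τ then 1 else 0)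

/-- The word `(σ_{j+1}, …, σ_n)` (0-indexed: the entries of `σ` at positions `j,…,n-1`). -/
def tailWord (n j : ℕ) (σ : Equiv.Perm (Fin n)) : Fin (n - j) → Fin n :=
  fun a => σ ⟨j + (a : ℕ), by have := a.isLt; omega⟩

/-- The word `(j+1, τ_{j+1}, …, τ_{i-1}, τ_{i+1}, …, τ_n)` (0-indexed: first letter the
value `j`, followed by the entries of `τ` at positions `j,…,n-1` skipping position `i`). -/
def wMinus (n j : ℕ) (i : Fin n) (τ : Equiv.Perm (Fin n)) : Fin (n - j) → Fin n :=
  fun a =>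
    if (a : ℕ) = 0 then ⟨j, by have := a.isLt; omega⟩
    else if j + (a : ℕ) - 1 < (i : ℕ) then τ ⟨j + (a : ℕ) - 1, by have := a.isLt; omega⟩
    else τ ⟨j + (a : ℕ), by have := a.isLt; omega⟩

/-- The eigenfunction `f_τ` attached to a non-identity permutation `τ`, where `j` is the
number of initial fixed points of `τ` and `i` is the position of the value `j` in `τ`. -/
def fTau (n j : ℕ) (i : Fin n) (τ σ : Equiv.Perm (Fin n)) : ℝ :=
  if std (tailWord n j σ) = std (tailWord n j τ) then 1
  else if std (tailWord n j σ) = std (wMinus n j i τ) then -1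
  else 0


/-- Insert a letter `v` at the front of the word `ρ`, raising the letters `≥ v` by one. -/
def consPerm {n : ℕ} (v : Fin (n + 1)) (ρ : Equiv.Perm (Fin n)) : Equiv.Perm (Fin (n + 1)) :=
  (finSuccEquiv' 0).trans (ρ.optionCongr.trans (finSuccEquiv' v).symm)

@[simp]
theorem consPerm_zero {n : ℕ} (v : Fin (n + 1)) (ρ : Equiv.Perm (Fin n)) :
    consPerm v ρ 0 = v := by
  simp [consPerm]

@[simp]
theorem consPerm_succ {n : ℕ} (v : Fin (n + 1)) (ρ : Equiv.Perm (Fin n)) (a : Fin n) :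
    consPerm v ρ a.succ = v.succAbove (ρ a) := by
  rw [← Fin.succAbove_zero_apply]
  simp only [consPerm, Equiv.trans_apply, finSuccEquiv'_succAbove, Equiv.optionCongr_apply,
    Option.map_some, finSuccEquiv'_symm_some]

/-- Delete the letter at position `p` from the word `τ` and standardise. -/
def deletePerm {n : ℕ} (p : Fin (n + 1)) (τ : Equiv.Perm (Fin (n + 1))) : Equiv.Perm (Fin n) :=
  (finSuccAboveEquiv p).trans
    ((τ.subtypeEquiv (p := (· ≠ p)) (q := (· ≠ τ p)) (by simp)).trans
      (finSuccAboveEquiv (τ p)).symm)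

theorem succAbove_deletePerm {n : ℕ} (p : Fin (n + 1)) (τ : Equiv.Perm (Fin (n + 1)))
    (a : Fin n) : (τ p).succAbove (deletePerm p τ a) = τ (p.succAbove a) :=
  congrArg Subtype.val ((finSuccAboveEquiv (τ p)).apply_symm_apply
    ⟨τ (p.succAbove a), by simp⟩)

/-- Delete the smallest letter of the word `τ` and standardise. -/
def deleteMin {n : ℕ} (τ : Equiv.Perm (Fin (n + 1))) : Equiv.Perm (Fin n) :=
  deletePerm (τ.symm 0) τ

theorem succ_deleteMin {n : ℕ} (τ : Equiv.Perm (Fin (n + 1))) (a : Fin n) :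
    (deleteMin τ a).succ = τ ((τ.symm 0).succAbove a) := by
  simpa [deleteMin] using succAbove_deletePerm (τ.symm 0) τ a

theorem deleteMin_eq {n : ℕ} {τ : Equiv.Perm (Fin (n + 1))} {ρ : Equiv.Perm (Fin n)}
    {p : Fin (n + 1)} (hp : τ p = 0) (h : ∀ a, τ (p.succAbove a) = (ρ a).succ) :
    deleteMin τ = ρ := by
  obtain rfl : p = τ.symm 0 := by simp [← hp]
  ext1 a
  exact Fin.succ_injective _ ((succ_deleteMin τ a).trans (h a))

theorem deleteMin_consPerm_zero {n : ℕ} (ρ : Equiv.Perm (Fin n)) :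
    deleteMin (consPerm 0 ρ) = ρ :=
  deleteMin_eq (p := 0) (by simp) (by simp)

theorem deleteMin_consPerm_succ {n : ℕ} (v : Fin (n + 1)) (ρ : Equiv.Perm (Fin (n + 1))) :
    deleteMin (consPerm v.succ ρ) = consPerm v (deleteMin ρ) := by
  refine deleteMin_eq (p := (ρ.symm 0).succ) (by simp) fun a => ?_
  cases a using Fin.cases with
  | zero => simp
  | succ b => simp [← succ_deleteMin]

theorem std_comp_perm {m : ℕ} {α : Type*} [LinearOrder α] {f : Fin m → α} (hf : StrictMono f)
    (ρ : Equiv.Perm (Fin m)) : std (fun a => f (ρ a)) = ρ := by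
  ext a
  have h : Finset.univ.filter (fun b => ρ b < ρ a) =
      (Finset.Iio (ρ a)).map ρ.symm.toEmbedding := by
    ext b
    simp
  simp [std, hf.lt_iff_lt, h]

theorem subMatch_one_iff {n : ℕ} (σ τ : Equiv.Perm (Fin (n + 1))) :
    subMatch (n + 1) 1 σ τ ↔ deletePerm 0 σ = deleteMin τ := by
  have hσ : std (fun a : Fin (n + 1 - 1) => σ ⟨1 + (a : ℕ), by have := a.isLt; omega⟩) =
      deletePerm 0 σ := by
    rw [← std_comp_perm (σ 0).strictMono_succAbove (deletePerm 0 σ)]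
    congr 1
    funext a
    rw [succAbove_deletePerm]
    congr 1
    ext
    simp [add_comm]
  have hτ : std (fun a => τ ((τ.symm 0).succAbove a)) = deleteMin τ := by
    simp_rw [← succ_deleteMin]
    exact std_comp_perm Fin.strictMono_succ _
  have hrange (p : Fin (n + 1)) :
      (∃ a, (τ.symm 0).succAbove a = p) ↔ 1 ≤ (τ p : ℕ) := by
    rw [Fin.exists_succAbove_eq_iff, Ne, Equiv.eq_symm_apply, Nat.one_le_iff_ne_zero, Ne,
      Fin.val_eq_zero_iff]
  unfold subMatch
  rw [hσ]
  constructor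
  · rintro ⟨g, hg, hgr, h⟩
    obtain rfl : g = (τ.symm 0).succAbove :=
      (StrictMono.range_inj hg (Fin.strictMono_succAbove _)).1
        (Set.ext fun p => (hgr p).trans (hrange p).symm)
    exact DFunLike.coe_injective (h.symm.trans hτ)
  · intro h
    exact ⟨(τ.symm 0).succAbove, Fin.strictMono_succAbove _, hrange, by rw [h]; exact hτ⟩

theorem deletePerm_zero_eq_iff {n : ℕ} (σ : Equiv.Perm (Fin (n + 1))) (ρ : Equiv.Perm (Fin n)) :
    deletePerm 0 σ = ρ ↔ ∃ v, consPerm v ρ = σ := by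
  constructor
  · rintro rfl
    refine ⟨σ 0, Equiv.ext fun a => ?_⟩
    cases a using Fin.cases with
    | zero => simp
    | succ b => simp [succAbove_deletePerm]
  · rintro ⟨v, rfl⟩
    ext1 a
    have h := succAbove_deletePerm 0 (consPerm v ρ) a
    simpa using h

theorem sum_mul_Ktr {n : ℕ} (f : Equiv.Perm (Fin (n + 1)) → ℝ) (τ : Equiv.Perm (Fin (n + 1))) :
    ∑ σ, f σ * Ktr (n + 1) σ τ = (∑ v, f (consPerm v (deleteMin τ))) / (n + 1) := by
  have hinj : Function.Injective fun v => consPerm v (deleteMin τ) := fun v w h => by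
    simpa using congrArg (fun σ => σ 0) h
  have himage : Finset.univ.filter (fun σ => ∃ v, consPerm v (deleteMin τ) = σ) =
      Finset.univ.image fun v => consPerm v (deleteMin τ) := by
    ext σ
    simp
  simp only [Ktr, Matrix.of_apply, subMatch_one_iff, deletePerm_zero_eq_iff, mul_ite, mul_zero]
  rw [← Finset.sum_filter, himage, Finset.sum_image hinj.injOn, Finset.sum_div]
  simp [div_eq_mul_inv]

theorem eq_of_sum_consPerm_deleteMin {n : ℕ} (f : Equiv.Perm (Fin (n + 1)) → ℝ)
    (hf : ∀ τ, ∑ v, f (consPerm v (deleteMin τ)) = (n + 1) * f τ)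
    (σ τ : Equiv.Perm (Fin (n + 1))) : f σ = f τ := by
  induction n with
  | zero => exact congrArg f (Equiv.ext fun _ => Subsingleton.elim (α := Fin 1) _ _)
  | succ n ih =>
    -- The averages over the fibres of deleting the first letter are again stationary.
    have hn : ((n : ℝ) + 2) ≠ 0 := by positivity
    set g : Equiv.Perm (Fin (n + 1)) → ℝ := fun ρ => (∑ v, f (consPerm v ρ)) / (n + 2) with hg
    have hfg (τ) : f τ = g (deleteMin τ) := by
      rw [hg, eq_div_iff hn]
      have h := hf τ
      push_cast at h
      linear_combination -h
    rw [hfg σ, hfg τ]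
    refine ih g (fun ρ => ?_) _ _
    have h : ∑ v, f (consPerm v ρ) = (n + 2) * g ρ := by
      rw [hg, mul_div_cancel₀ _ hn]
    simp_rw [hfg, Fin.sum_univ_succ, deleteMin_consPerm_zero, deleteMin_consPerm_succ] at h
    rw [Fin.sum_univ_succ]
    linear_combination h

/-- **The uniform distribution is the unique stationary distribution of the
top-to-random-with-standardisation chain on `S_n`** (`n ≥ 1`):
(i) `∑ σ (1/n!) ⬝ K n σ τ = 1/n!` for every `τ`; and
(ii) any probability distribution `π` on `S_n` with `∑ σ, π σ * K n σ τ = π τ` for all `τ`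
is the uniform distribution. -/
theorem topToRandomStd_uniform_unique_stationary (n : ℕ) (hn : 1 ≤ n) :
    (∀ τ : Equiv.Perm (Fin n),
        ∑ σ : Equiv.Perm (Fin n), (1 / (n.factorial : ℝ)) * Ktr n σ τ
          = 1 / (n.factorial : ℝ)) ∧
    (∀ π : Equiv.Perm (Fin n) → ℝ,
        (∀ σ, 0 ≤ π σ) → (∑ σ : Equiv.Perm (Fin n), π σ = 1) →
        (∀ τ : Equiv.Perm (Fin n), ∑ σ : Equiv.Perm (Fin n), π σ * Ktr n σ τ = π τ) →
        ∀ σ : Equiv.Perm (Fin n), π σ = 1 / (n.factorial : ℝ)) := by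
  obtain ⟨n, rfl⟩ := Nat.exists_eq_add_of_le' hn
  have hn' : (n : ℝ) + 1 ≠ 0 := by positivity
  refine ⟨fun τ => ?_, fun π _ hsum hπ σ => ?_⟩
  · rw [sum_mul_Ktr]
    simp [field]
  · have hconst := eq_of_sum_consPerm_deleteMin π fun τ => by
      rw [← hπ τ, sum_mul_Ktr, mul_div_cancel₀ _ hn']
    rw [Finset.sum_congr rfl fun τ _ => hconst τ σ] at hsum
    rw [eq_div_iff (by positivity), mul_comm]
    simpa [Fintype.card_perm] using hsum

end
end

section
/- Fix n ≥ 1 and τ ∈ S_n with τ ≠ id. Let j+1 be the smallest element of {1,…,n} with τ_{j+1} ≠ j+1, and let i be the index with τ_i = j+1 (so i > j+1). Define f_τ : S_n → ℝ by: f_τ(σ) = 1 if std(σ_{j+1},…,σ_n) = std(τ_{j+1},…,τ_n); f_τ(σ) = −1 if std(σ_{j+1},…,σ_n) = std(j+1, τ_{j+1},…,τ_{i−1}, τ_{i+1},…,τ_n); and f_τ(σ) = 0 otherwise. Then for every σ ∈ S_n: ∑_{τ'∈S_n} K_n(σ,τ')·f_τ(τ') = (j/n)·f_τ(σ), and for every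 q ∈ [0,1], ∑_{τ'∈S_n} K_n^q(σ,τ')·f_τ(τ') = q^{n−j}·f_τ(σ). That is, f_τ is a right eigenfunction of the top-to-random-with-standardisation chain with eigenvalue j/n, and of the binomial-top-to-random-with-standardisation chain with eigenvalue q^{n−j}. -/
open scoped Classical

noncomputable section

theorem std_lt_std_iff {m : ℕ} {α : Type*} [LinearOrder α] (w : Fin m → α) (a b : Fin m) :
    std w a < std w b ↔ w a < w b := by
  simp only [std, Fin.mk_lt_mk]
  constructor
  · intro h
    by_contra! hba
    refine absurd h (not_lt.2 (Finset.card_le_card fun c hc => ?_))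
    simp only [Finset.mem_filter, Finset.mem_univ, true_and] at hc ⊢
    exact hc.trans_le hba
  · intro h
    refine Finset.card_lt_card ((Finset.ssubset_iff_of_subset fun c hc => ?_).2 ⟨a, ?_, ?_⟩)
    · simp only [Finset.mem_filter, Finset.mem_univ, true_and] at hc ⊢
      exact hc.trans h
    · simpa using h
    · simp

/-- Two words have the same standardisation iff their letters compare in the same way. -/
theorem std_eq_std_iff {m : ℕ} {α β : Type*} [LinearOrder α] [LinearOrder β]
    (w : Fin m → α) (w' : Fin m → β) :
    std w = std w' ↔ ∀ a b, w a < w b ↔ w' a < w' b := by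
  constructor
  · intro h a b
    rw [← std_lt_std_iff, h, std_lt_std_iff]
  · intro h
    funext a
    simp only [std, Fin.mk.injEq]
    congr 1
    ext b
    simp [h b a]

theorem std_injective {m : ℕ} {α : Type*} [LinearOrder α] {w : Fin m → α}
    (hw : Function.Injective w) : Function.Injective (std w) := by
  intro a b hab
  by_contra hne
  rcases lt_or_gt_of_ne (hw.ne hne) with h | h
  · exact absurd hab ((std_lt_std_iff w a b).2 h).ne
  · exact absurd hab ((std_lt_std_iff w b a).2 h).ne'

theorem tailWord_injective (n j : ℕ) (σ : Equiv.Perm (Fin n)) :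
    Function.Injective (tailWord n j σ) := by
  intro a b h
  have := congrArg Fin.val (σ.injective h)
  simp only at this
  ext
  omega

theorem subMatch_iff (n r : ℕ) (σ τ : Equiv.Perm (Fin n)) :
    subMatch n r σ τ ↔ ∃ g : Fin (n - r) → Fin n, StrictMono g ∧
      (∀ p : Fin n, (∃ a, g a = p) ↔ r ≤ (τ p : ℕ)) ∧
      ∀ a b, τ (g a) < τ (g b) ↔ tailWord n r σ a < tailWord n r σ b := by
  simp only [subMatch, std_eq_std_iff, tailWord]

theorem StrictMono.fin_val_add_le {m n : ℕ} {f : Fin m → Fin n} (hf : StrictMono f)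
    (a : Fin m) : (f a : ℕ) + m ≤ n + a := by
  have key : ∀ d : ℕ, ∀ a : Fin m, (a : ℕ) + d + 1 = m → (f a : ℕ) + m ≤ n + a := by
    intro d
    induction d with
    | zero => intro a ha; have := (f a).isLt; omega
    | succ d ih =>
      intro a ha
      have hlt : f a < f ⟨a + 1, by omega⟩ := hf (Fin.mk_lt_mk.2 (by simp))
      have := ih ⟨a + 1, by omega⟩ (by simp only; omega)
      rw [Fin.lt_def] at hlt
      simp only at this
      omega
  exact key (m - 1 - a) a (by have := a.isLt; omega)

theorem Equiv.Perm.eq_of_lt_iff_lt {n : ℕ} {τ₁ τ₂ : Equiv.Perm (Fin n)}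
    (h : ∀ p q, τ₁ p < τ₁ q → τ₂ p < τ₂ q) : τ₁ = τ₂ := by
  have hmono : StrictMono (fun x => τ₂ (τ₁.symm x)) := fun x y hxy =>
    h _ _ (by simpa using hxy)
  have hid : (fun x => τ₂ (τ₁.symm x)) = id :=
    (hmono.range_inj strictMono_id).1 <| by
      rw [Set.range_id]
      exact (τ₁.symm.trans τ₂).surjective.range_eq
  ext p
  simpa using (congrArg Fin.val (congrFun hid (τ₁ p))).symm

/-- A match of the entries `≥ r` is determined by the positions of the entries `< r`. -/
theorem subMatch.eq_of_symm_eq {n r : ℕ} {σ τ₁ τ₂ : Equiv.Perm (Fin n)}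
    (h₁ : subMatch n r σ τ₁) (h₂ : subMatch n r σ τ₂)
    (hsymm : ∀ x : Fin n, (x : ℕ) < r → τ₁.symm x = τ₂.symm x) : τ₁ = τ₂ := by
  obtain ⟨g₁, hg₁, hr₁, hp₁⟩ := (subMatch_iff n r σ τ₁).1 h₁
  obtain ⟨g₂, hg₂, hr₂, hp₂⟩ := (subMatch_iff n r σ τ₂).1 h₂
  have hsmall₁ : ∀ p, (τ₁ p : ℕ) < r → τ₂ p = τ₁ p := fun p hp => by
    have := hsymm (τ₁ p) hp
    rw [Equiv.symm_apply_apply] at this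
    exact ((Equiv.eq_symm_apply τ₂).1 this)
  have hsmall₂ : ∀ p, (τ₂ p : ℕ) < r → τ₁ p = τ₂ p := fun p hp => by
    have := hsymm (τ₂ p) hp
    rw [Equiv.symm_apply_apply] at this
    exact ((Equiv.symm_apply_eq τ₁).1 this).symm
  have hbig : ∀ p, r ≤ (τ₁ p : ℕ) ↔ r ≤ (τ₂ p : ℕ) := by
    intro p
    constructor
    · intro h
      by_contra! hlt
      have := hsmall₂ p hlt
      rw [this] at h
      omega
    · intro h
      by_contra! hlt
      have := hsmall₁ p hlt
      rw [this] at h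
      omega
  have hg : g₁ = g₂ := (hg₁.range_inj hg₂).1 <| by
    ext p
    rw [Set.mem_range, Set.mem_range, hr₁, hr₂, hbig]
  subst hg
  refine Equiv.Perm.eq_of_lt_iff_lt fun p q hpq => ?_
  by_cases hp : r ≤ (τ₁ p : ℕ)
  · obtain ⟨a, rfl⟩ := (hr₁ p).2 hp
    obtain ⟨b, rfl⟩ := (hr₁ q).2 (hp.trans hpq.le)
    exact (hp₂ a b).2 ((hp₁ a b).1 hpq)
  · push Not at hp
    rw [hsmall₁ p hp]
    by_cases hq : r ≤ (τ₁ q : ℕ)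
    · exact Fin.lt_def.2 (hp.trans_le ((hbig q).1 hq))
    · rwa [hsmall₁ q (not_le.1 hq)]

/-- The positions of the entries `< r` of a match can be prescribed arbitrarily. -/
theorem exists_subMatch_of_injective {n r : ℕ} (hr : r ≤ n) (σ : Equiv.Perm (Fin n))
    (e : Fin r → Fin n) (he : Function.Injective e) :
    ∃ τ : Equiv.Perm (Fin n), subMatch n r σ τ ∧
      ∀ x : Fin r, τ.symm (Fin.castLE hr x) = e x := by
  have hcard : (Finset.univ.image e)ᶜ.card = n - r := by
    rw [Finset.card_compl, Finset.card_image_of_injective _ he]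
    simp
  let g := (Finset.univ.image e)ᶜ.orderEmbOfFin hcard
  have hge : ∀ a x, g a ≠ e x := fun a x h => by
    have := (Finset.univ.image e)ᶜ.orderEmbOfFin_mem hcard a
    rw [Finset.mem_compl] at this
    exact this (Finset.mem_image.2 ⟨x, Finset.mem_univ x, h.symm⟩)
  let π : Equiv.Perm (Fin (n - r)) := Equiv.ofBijective _
    (Finite.injective_iff_bijective.1 (std_injective (tailWord_injective n r σ)))
  let ρ : Fin n → Fin n := fun x =>
    if h : (x : ℕ) < r then e ⟨x, h⟩
    else g (π.symm ⟨x - r, by have := x.isLt; omega⟩)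
  have hρ_inj : Function.Injective ρ := by
    intro x y hxy
    simp only [ρ] at hxy
    split_ifs at hxy with hx hy hy
    · simpa [Fin.ext_iff] using he hxy
    · exact absurd hxy.symm (hge _ _)
    · exact absurd hxy (hge _ _)
    · have := congrArg Fin.val (π.symm.injective (g.injective hxy))
      simp only at this
      ext
      omega
  let ρ' : Equiv.Perm (Fin n) :=
    Equiv.ofBijective ρ (Finite.injective_iff_bijective.1 hρ_inj)
  have hg_val : ∀ a, (ρ'.symm (g a) : ℕ) = r + π a := by
    intro a
    have : ρ'.symm (g a) = ⟨r + π a, by have := (π a).isLt; omega⟩ := by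
      rw [Equiv.symm_apply_eq]
      simp [ρ', ρ]
    rw [this]
  refine ⟨ρ'.symm, (subMatch_iff _ _ _ _).2 ⟨g, g.strictMono, fun p => ?_, fun a b => ?_⟩, ?_⟩
  · constructor
    · rintro ⟨a, rfl⟩
      rw [hg_val]
      omega
    · intro h
      obtain ⟨x, rfl⟩ := ρ'.surjective p
      rw [Equiv.symm_apply_apply] at h
      exact ⟨_, by simp only [ρ', ρ, Equiv.ofBijective_apply, dif_neg (not_lt.2 h)]; rfl⟩
  · rw [← std_lt_std_iff (tailWord n r σ), Fin.lt_def, hg_val, hg_val, Nat.add_lt_add_iff_left]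
    rfl
  · intro x
    simp [ρ', ρ]

/-- The number of matches whose entries `< r` all lie in the first `j` positions. -/
theorem card_subMatch_forall_le {n r j : ℕ} (hr : r ≤ n) (hj : j ≤ n)
    (σ : Equiv.Perm (Fin n)) :
    (Finset.univ.filter fun τ : Equiv.Perm (Fin n) =>
      subMatch n r σ τ ∧ ∀ p : Fin n, j ≤ (p : ℕ) → r ≤ (τ p : ℕ)).card
      = j.descFactorial r := by
  have hlt : ∀ τ : Equiv.Perm (Fin n), (∀ p : Fin n, j ≤ (p : ℕ) → r ≤ (τ p : ℕ)) →
      ∀ x : Fin r, (τ.symm (Fin.castLE hr x) : ℕ) < j := by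
    intro τ hτ x
    by_contra! h
    have := hτ _ h
    rw [Equiv.apply_symm_apply, Fin.val_castLE] at this
    omega
  have hemb : (Finset.univ : Finset (Fin r ↪ Fin j)).card = j.descFactorial r := by
    rw [Finset.card_univ, Fintype.card_embedding_eq, Fintype.card_fin, Fintype.card_fin]
  rw [← hemb]
  refine Finset.card_bij (fun τ hτ => ⟨fun x => ⟨τ.symm (Fin.castLE hr x),
    hlt τ (Finset.mem_filter.1 hτ).2.2 x⟩, fun x y h => ?_⟩)
    (fun _ _ => Finset.mem_univ _) (fun τ₁ h₁ τ₂ h₂ h => ?_) (fun e _ => ?_)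
  · exact Fin.castLE_injective hr (τ.symm.injective (Fin.ext (Fin.mk.inj h)))
  · refine (Finset.mem_filter.1 h₁).2.1.eq_of_symm_eq (Finset.mem_filter.1 h₂).2.1 fun x hx => ?_
    have := congrArg Fin.val (DFunLike.congr_fun h ⟨x, hx⟩)
    exact Fin.ext this
  · obtain ⟨τ, hτ, hτe⟩ := exists_subMatch_of_injective hr σ
      (fun x => Fin.castLE hj (e x)) ((Fin.castLE_injective hj).comp e.injective)
    refine ⟨τ, Finset.mem_filter.2 ⟨Finset.mem_univ _, hτ, fun p hp => ?_⟩, ?_⟩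
    · by_contra! h
      have h1 := hτe ⟨τ p, h⟩
      rw [show Fin.castLE hr ⟨(τ p : ℕ), h⟩ = τ p from rfl, Equiv.symm_apply_apply] at h1
      have := (e ⟨τ p, h⟩).isLt
      rw [h1, Fin.val_castLE] at hp
      omega
    · ext x
      simp [hτe]

/-- If all entries `< r` of `τ` lie before position `j`, a match of `τ` with `σ` identifies the
patterns of the last `n - j` letters. -/
theorem subMatch.std_tailWord_eq {n r j : ℕ} (hr : r ≤ n) {σ τ : Equiv.Perm (Fin n)}
    (h : subMatch n r σ τ) (hτ : ∀ p : Fin n, j ≤ (p : ℕ) → r ≤ (τ p : ℕ)) :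
    std (tailWord n j τ) = std (tailWord n j σ) := by
  obtain ⟨g, hg, hrange, hpat⟩ := (subMatch_iff n r σ τ).1 h
  have hex : ∀ b : Fin (n - j), ∃ a, g a = ⟨j + b, by have := b.isLt; omega⟩ := fun b =>
    (hrange _).2 (hτ _ (by simp))
  choose g' hg' using hex
  have hmono : StrictMono g' := fun b c hbc => by
    rw [← hg.lt_iff_lt, hg', hg']
    simpa using hbc
  have hval : ∀ b, r + (g' b : ℕ) = j + b := fun b => by
    have h1 := hg.fin_val_add_le (g' b)
    have h2 := hmono.fin_val_add_le b
    rw [hg'] at h1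
    simp only at h1
    have := b.isLt
    omega
  rw [std_eq_std_iff]
  intro a b
  have hpat' := hpat (g' a) (g' b)
  simp only [hg', tailWord, hval] at hpat'
  exact hpat'

/-- The permutation of positions which moves position `i` in front of position `j`
(the identity if `i < j`). -/
def moveFront {n : ℕ} (j i : Fin n) : Equiv.Perm (Fin n) :=
  Equiv.ofBijective
    (fun p => if p = j then max i j
      else if h : j < p ∧ p ≤ i then ⟨p - 1, by have := p.isLt; omega⟩ else p)
    (Finite.injective_iff_bijective.1 <| by
      intro p q hpq
      simp only [max_def, Fin.lt_def, Fin.le_def] at hpq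
      split_ifs at hpq <;> simp only [Fin.ext_iff] at * <;> omega)

theorem moveFront_val {n : ℕ} (j i p : Fin n) :
    (moveFront j i p : ℕ) = if (p : ℕ) = j then max (i : ℕ) j
      else if (j : ℕ) < p ∧ (p : ℕ) ≤ i then (p : ℕ) - 1 else p := by
  simp only [moveFront, Equiv.ofBijective_apply, Fin.ext_iff, Fin.lt_def, Fin.le_def]
  split_ifs <;> rfl

theorem moveFront_self {n : ℕ} {j i : Fin n} (hji : j ≤ i) : moveFront j i j = i := by
  ext
  simpa [moveFront_val] using hji

theorem moveFront_lt_moveFront {n : ℕ} {j i p q : Fin n} (hp : p ≠ j) (hq : q ≠ j)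
    (hpq : p < q) : moveFront j i p < moveFront j i q := by
  rw [Fin.lt_def, moveFront_val, moveFront_val]
  rw [Ne, Fin.ext_iff] at hp hq
  rw [Fin.lt_def] at hpq
  split_ifs <;> omega

theorem le_moveFront_iff {n : ℕ} (j i p : Fin n) :
    j ≤ moveFront j i p ↔ j ≤ p := by
  rw [Fin.le_def, Fin.le_def, moveFront_val]
  split_ifs <;> omega

/-- Moving an entry `< r` does not change the subword of the entries `≥ r`. -/
theorem subMatch_mul_moveFront {n r : ℕ} {j i : Fin n} {σ τ : Equiv.Perm (Fin n)}
    (hji : j ≤ i) (hi : (τ i : ℕ) < r) :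
    subMatch n r σ (τ * moveFront j i) ↔ subMatch n r σ τ := by
  rw [subMatch_iff, subMatch_iff]
  constructor
  · rintro ⟨g, hg, hrange, hpat⟩
    have hne : ∀ a, g a ≠ j := fun a ha => by
      have := (hrange (g a)).1 ⟨a, rfl⟩
      rw [ha, Equiv.Perm.mul_apply, moveFront_self hji] at this
      omega
    refine ⟨fun a => moveFront j i (g a),
      fun a b hab => moveFront_lt_moveFront (hne a) (hne b) (hg hab), fun p => ?_, hpat⟩
    have := hrange ((moveFront j i).symm p)
    rw [Equiv.Perm.mul_apply, Equiv.apply_symm_apply] at this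
    simpa only [Equiv.eq_symm_apply] using this
  · rintro ⟨g, hg, hrange, hpat⟩
    have hne : ∀ a, (moveFront j i).symm (g a) ≠ j := fun a ha => by
      rw [Equiv.symm_apply_eq, moveFront_self hji] at ha
      have := (hrange (g a)).1 ⟨a, rfl⟩
      rw [ha] at this
      omega
    refine ⟨fun a => (moveFront j i).symm (g a), fun a b hab => ?_, fun p => ?_, fun a b => ?_⟩
    · by_contra! hle
      rcases hle.eq_or_lt with h | h
      · exact (hg hab).ne' ((moveFront j i).symm.injective h)
      · have := moveFront_lt_moveFront (i := i) (hne b) (hne a) h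
        simp only [Equiv.apply_symm_apply] at this
        exact this.not_gt (hg hab)
    · rw [Equiv.Perm.mul_apply, ← hrange]
      simp only [Equiv.symm_apply_eq]
    · simpa using hpat a b

theorem std_tailWord_eq_iff {n : ℕ} (j : Fin n) (σ τ : Equiv.Perm (Fin n)) :
    std (tailWord n j σ) = std (tailWord n j τ) ↔
      ∀ p q : Fin n, j ≤ p → j ≤ q → (σ p < σ q ↔ τ p < τ q) := by
  rw [std_eq_std_iff]
  constructor
  · intro h p q hp hq
    rw [Fin.le_def] at hp hq
    have := h ⟨p - j, by have := p.isLt; omega⟩ ⟨q - j, by have := q.isLt; omega⟩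
    simpa only [tailWord, Nat.add_sub_cancel' hp, Nat.add_sub_cancel' hq] using this
  · exact fun h a b => h _ _ (by simp [Fin.le_def]) (by simp [Fin.le_def])

theorem std_tailWord_mul_moveFront_eq_iff {n : ℕ} (j i : Fin n)
    (σ τ : Equiv.Perm (Fin n)) :
    std (tailWord n j (σ * moveFront j i)) = std (tailWord n j (τ * moveFront j i)) ↔
      std (tailWord n j σ) = std (tailWord n j τ) := by
  rw [std_tailWord_eq_iff, std_tailWord_eq_iff]
  simp only [Equiv.Perm.mul_apply]
  constructor
  · intro h p q hp hq
    have := h ((moveFront j i).symm p) ((moveFront j i).symm q)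
    simp only [← le_moveFront_iff j i ((moveFront j i).symm _), Equiv.apply_symm_apply] at this
    exact this hp hq
  · exact fun h p q hp hq =>
      h _ _ ((le_moveFront_iff j i p).2 hp) ((le_moveFront_iff j i q).2 hq)

theorem wMinus_eq_tailWord {n : ℕ} {j i : Fin n} {τ : Equiv.Perm (Fin n)}
    (hji : j ≤ i) (hi : τ i = j) :
    wMinus n j i τ = tailWord n j (τ * moveFront j i) := by
  rw [Fin.le_def] at hji
  funext a
  have hlt : (j : ℕ) + a < n := by have := a.isLt; omega
  simp only [wMinus, tailWord, Equiv.Perm.mul_apply]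
  have hval := moveFront_val j i ⟨j + a, hlt⟩
  simp only at hval
  split_ifs with h0 h1
  · have : moveFront j i ⟨j + a, hlt⟩ = i := Fin.ext (by rw [hval, if_pos (by omega), max_eq_left hji])
    rw [this, hi]
  · congr 1
    exact Fin.ext (by rw [hval, if_neg (by omega), if_pos (by omega)])
  · congr 1
    exact Fin.ext (by rw [hval, if_neg (by omega), if_neg (by omega)])

/-- `f_τ` is the difference of two indicator functions of patterns of the last letters. -/
theorem fTau_eq_sub {n : ℕ} {j i : Fin n} {τ : Equiv.Perm (Fin n)}
    (hji : j < i) (hi : τ i = j) (hmin : ∀ p, j ≤ p → j ≤ τ p) (σ : Equiv.Perm (Fin n)) :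
    fTau n j i τ σ = (if std (tailWord n j σ) = std (tailWord n j τ) then 1 else 0)
      - (if std (tailWord n j σ) = std (tailWord n j (τ * moveFront j i)) then 1 else 0) := by
  have hne : std (tailWord n j τ) ≠ std (tailWord n j (τ * moveFront j i)) := by
    rw [Ne, std_tailWord_eq_iff]
    intro h
    have h1 := (h i j hji.le le_rfl).1 (by
      rw [hi]
      exact lt_of_le_of_ne (hmin j le_rfl) fun h => hji.ne' (τ.injective (hi.trans h)))
    rw [Equiv.Perm.mul_apply, Equiv.Perm.mul_apply, moveFront_self hji.le, hi] at h1
    exact h1.not_ge (hmin _ ((le_moveFront_iff j i i).2 hji.le))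
  rw [fTau, wMinus_eq_tailWord hji.le hi]
  by_cases h : std (tailWord n j σ) = std (tailWord n j τ)
  · simp [h, hne]
  · by_cases h' : std (tailWord n j σ) = std (tailWord n j (τ * moveFront j i)) <;>
      simp [h, h', hne.symm]

/-- The number of matches with a given pattern of the last letters, split according to whether
some entry `< r` occurs in these letters. -/
theorem sum_subMatch_mul_indicator {n r : ℕ} (hr : r ≤ n) (j : Fin n)
    (σ τ : Equiv.Perm (Fin n)) :
    ∑ τ' : Equiv.Perm (Fin n), (if subMatch n r σ τ' then (1 : ℝ) else 0) *
        (if std (tailWord n j τ') = std (tailWord n j τ) then 1 else 0)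
      = ((j : ℕ).descFactorial r : ℝ) *
          (if std (tailWord n j σ) = std (tailWord n j τ) then 1 else 0)
        + ∑ τ' : Equiv.Perm (Fin n), if (∃ p, j ≤ p ∧ (τ' p : ℕ) < r) ∧ subMatch n r σ τ' ∧
            std (tailWord n j τ') = std (tailWord n j τ) then 1 else 0 := by
  rw [← card_subMatch_forall_le hr j.isLt.le σ, Finset.card_filter, Nat.cast_sum,
    Finset.sum_mul, ← Finset.sum_add_distrib]
  refine Finset.sum_congr rfl fun τ' _ => ?_
  by_cases hm : subMatch n r σ τ'
  · by_cases hs : ∃ p, j ≤ p ∧ (τ' p : ℕ) < r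
    · have hs' : ¬ ∀ p : Fin n, j ≤ p → r ≤ (τ' p : ℕ) := by
        obtain ⟨p, hp, hlt⟩ := hs
        exact fun h => absurd (h p hp) (not_le.2 hlt)
      simp [hm, hs, -not_forall, hs']
    · have hs' : ∀ p : Fin n, j ≤ p → r ≤ (τ' p : ℕ) := fun p hp => by
        by_contra! h
        exact hs ⟨p, hp, h⟩
      rw [hm.std_tailWord_eq hr hs']
      simp [hm, hs, if_pos hs']
  · simp [hm]

theorem sum_subMatch_mul_fTau {n r : ℕ} (hr : r ≤ n) {j i : Fin n} {τ : Equiv.Perm (Fin n)}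
    (hji : j < i) (hi : τ i = j) (hmin : ∀ p, j ≤ p → j ≤ τ p) (σ : Equiv.Perm (Fin n)) :
    ∑ τ' : Equiv.Perm (Fin n), (if subMatch n r σ τ' then (1 : ℝ) else 0) * fTau n j i τ τ'
      = ((j : ℕ).descFactorial r : ℝ) * fTau n j i τ σ := by
  simp only [fTau_eq_sub hji hi hmin, mul_sub, Finset.sum_sub_distrib]
  rw [sum_subMatch_mul_indicator hr, sum_subMatch_mul_indicator hr, add_sub_add_comm,
    add_eq_left, sub_eq_zero]
  refine Fintype.sum_equiv (Equiv.mulRight (moveFront j i)) _ _ fun τ' => ?_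
  simp only [Equiv.coe_mulRight, std_tailWord_mul_moveFront_eq_iff]
  have hex : (∃ p, j ≤ p ∧ ((τ' * moveFront j i) p : ℕ) < r) ↔ ∃ p, j ≤ p ∧ (τ' p : ℕ) < r := by
    rw [← (moveFront j i).exists_congr_right (q := fun p => j ≤ p ∧ (τ' p : ℕ) < r)]
    simp only [le_moveFront_iff, Equiv.Perm.mul_apply]
  simp only [hex]
  refine if_congr (and_congr_right fun ⟨p, hp, hpr⟩ => and_congr_left fun hpat => ?_) rfl rfl
  refine (subMatch_mul_moveFront hji.le (lt_of_le_of_lt ?_ hpr)).symm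
  have := (std_tailWord_eq_iff j τ' τ).1 hpat p i hp hji.le
  rw [hi] at this
  exact Fin.le_def.1 (not_lt.1 fun h => (this.1 h).not_ge (hmin p hp))

theorem sum_pow_mul_descFactorial_div_factorial {n j : ℕ} (hj : j ≤ n) (q : ℝ) :
    ∑ r ∈ Finset.range (n + 1),
      (1 - q) ^ r * q ^ (n - r) / (r.factorial : ℝ) * (j.descFactorial r : ℝ) = q ^ (n - j) := by
  have hsub : Finset.range (j + 1) ⊆ Finset.range (n + 1) :=
    Finset.range_subset_range.2 (by omega)
  rw [← Finset.sum_subset hsub fun r _ hr => by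
    rw [Nat.descFactorial_of_lt (by simpa using hr)]
    simp]
  have hbinom := add_pow (1 - q) q j
  rw [sub_add_cancel, one_pow] at hbinom
  conv_rhs => rw [← mul_one (q ^ (n - j)), hbinom, Finset.mul_sum]
  refine Finset.sum_congr rfl fun r hr => ?_
  have hrj : r ≤ j := by simpa [Nat.lt_succ_iff] using hr
  rw [Nat.descFactorial_eq_factorial_mul_choose, Nat.cast_mul,
    show n - r = (n - j) + (j - r) by omega, pow_add]
  have : (r.factorial : ℝ) ≠ 0 := by positivity
  field_simp

/-- **`f_τ` is a right eigenfunction** of the top-to-random-with-standardisation chain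
with eigenvalue `j/n`, and of the binomial-top-to-random-with-standardisation chain with
eigenvalue `q^(n-j)`.  Here `τ ≠ id`, `j` is the number of initial fixed points of `τ`
(0-indexed: `τ` fixes all positions `< j` but not position `j`), and the distinguished
index `i` is `τ⁻¹ j`. -/
theorem fTau_right_eigenfunction (n : ℕ) (hn : 1 ≤ n)
    (τ : Equiv.Perm (Fin n)) (hτ : τ ≠ 1)
    (j : ℕ) (hj : j < n)
    (hfix : ∀ m : Fin n, (m : ℕ) < j → τ m = m)
    (hmove : τ ⟨j, hj⟩ ≠ ⟨j, hj⟩) :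
    (∀ σ : Equiv.Perm (Fin n),
        ∑ τ' : Equiv.Perm (Fin n), Ktr n σ τ' * fTau n j (τ.symm ⟨j, hj⟩) τ τ'
          = ((j : ℝ) / (n : ℝ)) * fTau n j (τ.symm ⟨j, hj⟩) τ σ) ∧
    (∀ q : ℝ, 0 ≤ q → q ≤ 1 → ∀ σ : Equiv.Perm (Fin n),
        ∑ τ' : Equiv.Perm (Fin n), Kq n q σ τ' * fTau n j (τ.symm ⟨j, hj⟩) τ τ'
          = q ^ (n - j) * fTau n j (τ.symm ⟨j, hj⟩) τ σ) := by
  set i := τ.symm ⟨j, hj⟩ with hi_def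
  have hi : τ i = ⟨j, hj⟩ := τ.apply_symm_apply _
  have hmin : ∀ p : Fin n, ⟨j, hj⟩ ≤ p → (⟨j, hj⟩ : Fin n) ≤ τ p := by
    intro p hp
    by_contra! hlt
    exact hp.not_gt (τ.injective (hfix (τ p) hlt) ▸ hlt)
  have hji : (⟨j, hj⟩ : Fin n) < i := by
    refine lt_of_not_ge fun hle => ?_
    rcases hle.eq_or_lt with h | h
    · exact hmove (h ▸ hi)
    · exact h.ne ((hfix i h).symm.trans hi)
  have key : ∀ r ≤ n, ∀ σ, ∑ τ' : Equiv.Perm (Fin n),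
      (if subMatch n r σ τ' then (1 : ℝ) else 0) * fTau n j i τ τ'
        = (j.descFactorial r : ℝ) * fTau n j i τ σ := fun r hr σ =>
    sum_subMatch_mul_fTau hr hji hi hmin σ
  refine ⟨fun σ => ?_, fun q _ _ σ => ?_⟩
  · have h1 := key 1 hn σ
    rw [Nat.descFactorial_one] at h1
    rw [div_mul_eq_mul_div, ← h1, Finset.sum_div]
    refine Finset.sum_congr rfl fun τ' _ => ?_
    simp only [Ktr, Matrix.of_apply]
    split_ifs <;> ring
  · simp only [Kq, Matrix.of_apply, Finset.sum_mul]
    rw [Finset.sum_comm, ← sum_pow_mul_descFactorial_div_factorial hj.le q, Finset.sum_mul]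
    refine Finset.sum_congr rfl fun r hr => ?_
    rw [mul_assoc, ← key r (by simpa [Nat.lt_succ_iff] using hr) σ, Finset.mul_sum]
    exact Finset.sum_congr rfl fun τ' _ => mul_assoc _ _ _

end
end

section
/- For every rooted subtree T' of T0 with n' := |T'| ≥ 2, define f_{T'} on the set of rooted subtrees of T0 by f_{T'}(T) = C(|T|, n') · #{linear extensions φ : T → {1,…,|T|} with φ^{−1}({1,…,n'}) = T'} / ℓ(T), where C(·,·) is a binomial coefficient (so f_{T'}(T) = 0 unless T' ⊆ T). Then f_{T'} is a right eigenfunction of the single-model firing chain with eigenvalue (n0 − n')/n0, i.e. ∑_{T''} K(T,T'')·f_{T'}(T'') = ((n0 − n')/n0)·f_{T'}(T) for every rooted subtree T. Moreover these functions, together with the constant function 1, form a basis of the space of all real-valued functions on the set of rooted subtrees of T0. -/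
open scoped Classical

noncomputable section

/-- A rooted subtree of the finite rooted-tree poset `V`: a nonempty lower set,
recorded as a `Finset`. -/
abbrev RSub (V : Type) [PartialOrder V] : Type :=
  {T : Finset V // T.Nonempty ∧ ∀ ⦃a b : V⦄, a ≤ b → b ∈ T → a ∈ T}

/-- `linExt T` : the number of linear extensions of the sub-poset `T`, i.e. of
order-preserving bijections from `T` (with the induced order) to the chain
`{1 < 2 < … < |T|}`. -/
def linExt {V : Type} [PartialOrder V] (T : Finset V) : ℕ :=
  Nat.card {φ : {x // x ∈ T} ≃ Fin T.card //
    ∀ a b : {x // x ∈ T}, (a : V) ≤ (b : V) → (φ a : ℕ) ≤ (φ b : ℕ)}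

/-- The transition matrix of the single-model employee-firing chain on the rooted
subtrees of `V`:  from a state `T` with at least two elements, stay put with probability
`(n₀ - |T|)/n₀`, and move to `T \ {v}` (for `v` a maximal element of `T`) with
probability `(|T|/n₀) ⬝ ℓ(T\{v})/ℓ(T)`;  the singleton root is absorbing. -/
def Kfire {V : Type} [Fintype V] [PartialOrder V] (T T' : RSub V) : ℝ :=
  if 2 ≤ T.1.card then
    if T' = T then ((Fintype.card V : ℝ) - (T.1.card : ℝ)) / (Fintype.card V : ℝ)
    else if ∃ v ∈ T.1, (∀ w ∈ T.1, v ≤ w → w = v) ∧ T'.1 = T.1.erase v then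
      ((T.1.card : ℝ) / (Fintype.card V : ℝ)) * (linExt T'.1 : ℝ) / (linExt T.1 : ℝ)
    else 0
  else if T' = T then 1 else 0

/-- `Kfire` as a square matrix indexed by the rooted subtrees of `V`. -/
def KfireM (V : Type) [Fintype V] [PartialOrder V] : Matrix (RSub V) (RSub V) ℝ :=
  Matrix.of fun T T' => Kfire T T'


/-- `linExtTo T T'` : the number of order-preserving bijections from `T` to the chain
`{1 < … < |T|}` under which `T'` is exactly the preimage of `{1, …, |T'|}`
(0-indexed: of `{0, …, |T'| - 1}`). -/
def linExtTo {V : Type} [PartialOrder V] (T T' : Finset V) : ℕ :=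
  Nat.card {φ : {x // x ∈ T} ≃ Fin T.card //
    (∀ a b : {x // x ∈ T}, (a : V) ≤ (b : V) → (φ a : ℕ) ≤ (φ b : ℕ)) ∧
    (∀ a : {x // x ∈ T}, (φ a : ℕ) < T'.card ↔ (a : V) ∈ T')}

/-- The right eigenfunction attached to a rooted subtree `T'` with `n' = |T'|`:
`f_{T'}(T) = C(|T|, n') ⬝ #{linear extensions φ of T with φ⁻¹({1,…,n'}) = T'} / ℓ(T)`. -/
def fE {V : Type} [PartialOrder V] (T' T : RSub V) : ℝ :=
  (Nat.choose T.1.card T'.1.card : ℝ) * (linExtTo T.1 T'.1 : ℝ) / (linExt T.1 : ℝ)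

/-- Linear extensions of `T` with initial segment `T'`, encoded as functions on the ambient
type that vanish outside `T`. -/
def LinFun {V : Type} [PartialOrder V] (T T' : Finset V) : Type :=
  {f : V → ℕ // (∀ x, x ∉ T → f x = 0) ∧ (∀ a ∈ T, ∀ b ∈ T, f a = f b → a = b) ∧
    (∀ x ∈ T, f x < T.card) ∧ (∀ a ∈ T, ∀ b ∈ T, a ≤ b → f a ≤ f b) ∧
    ∀ a ∈ T, (f a < T'.card ↔ a ∈ T')}

section LinearExtensions

variable {V : Type} [PartialOrder V]

theorem linExtTo_eq_card_linFun (T T' : Finset V) :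
    linExtTo T T' = Nat.card (LinFun T T') := by
  refine Nat.card_congr (Equiv.ofBijective
    (fun φ => ⟨fun x => if h : x ∈ T then (φ.1 ⟨x, h⟩ : ℕ) else 0, ?_, ?_, ?_, ?_, ?_⟩) ⟨?_, ?_⟩)
  · intro x hx
    simp [hx]
  · intro a ha b hb h
    simpa [ha, hb, Fin.val_inj] using h
  · intro x hx
    simp [hx]
  · intro a ha b hb h
    simpa [ha, hb] using φ.2.1 ⟨a, ha⟩ ⟨b, hb⟩ h
  · intro a ha
    simpa [ha] using φ.2.2 ⟨a, ha⟩
  · intro φ ψ h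
    apply Subtype.ext
    ext ⟨x, hx⟩
    simpa [hx] using congrFun (congrArg Subtype.val h) x
  · rintro ⟨f, h0, hinj, hlt, hmono, hto⟩
    have hbij : Function.Bijective
        (fun x : {x // x ∈ T} => (⟨f x, hlt x x.2⟩ : Fin T.card)) := by
      rw [Fintype.bijective_iff_injective_and_card]
      refine ⟨fun a b h => Subtype.ext (hinj a a.2 b b.2 (Fin.mk.inj_iff.1 h)), by simp⟩
    refine ⟨⟨Equiv.ofBijective _ hbij, fun a b h => hmono a a.2 b b.2 h,
      fun a => hto a a.2⟩, Subtype.ext (funext fun x => ?_)⟩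
    by_cases hx : x ∈ T
    · simp [hx]
    · simp [hx, h0 x hx]

theorem LinFun.exists_eq {T T' : Finset V} (f : LinFun T T') {k : ℕ} (hk : k < T.card) :
    ∃ a ∈ T, f.1 a = k := by
  obtain ⟨f, -, hinj, hlt, -⟩ := f
  have : T.image f = Finset.range T.card := by
    apply Finset.eq_of_subset_of_card_le
    · intro y hy
      obtain ⟨x, hx, rfl⟩ := Finset.mem_image.1 hy
      exact Finset.mem_range.2 (hlt x hx)
    · rw [Finset.card_range, Finset.card_image_of_injOn (fun a ha b hb h => hinj a ha b hb h)]
  exact Finset.mem_image.1 (this ▸ Finset.mem_range.2 hk)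

theorem LinFun.subset {T T' : Finset V} (f : LinFun T T') (h : T'.card ≤ T.card) :
    T' ⊆ T := by
  have hsub : Finset.range T'.card ⊆ (T' ∩ T).image f.1 := by
    intro k hk
    obtain ⟨a, ha, rfl⟩ := f.exists_eq ((Finset.mem_range.1 hk).trans_le h)
    exact Finset.mem_image_of_mem _
      (Finset.mem_inter.2 ⟨(f.2.2.2.2.2 a ha).1 (Finset.mem_range.1 hk), ha⟩)
  have hcard := (Finset.card_le_card hsub).trans Finset.card_image_le
  rw [Finset.card_range] at hcard
  exact Finset.inter_eq_left.1 (Finset.eq_of_subset_of_card_le Finset.inter_subset_left hcard)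

/-- Insert a maximal element `v` at the top of a linear extension of `T.erase v`. -/
def LinFun.insertTop {T T' : Finset V} (hc : T'.card < T.card) {v : V} (hv : v ∈ T)
    (hmax : ∀ w ∈ T, v ≤ w → w = v) (g : LinFun (T.erase v) T') : LinFun T T' :=
  ⟨Function.update g.1 v (T.card - 1), by
    have hvT' : v ∉ T' := fun h =>
      Finset.notMem_erase v T (g.subset (by rw [Finset.card_erase_of_mem hv]; omega) h)
    obtain ⟨g, h0, hinj, hlt, hmono, hto⟩ := g
    simp only [Finset.card_erase_of_mem hv, Finset.mem_erase] at h0 hinj hlt hmono hto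
    refine ⟨?_, ?_, ?_, ?_, ?_⟩
    · intro x hx
      have : x ≠ v := fun h => hx (h ▸ hv)
      simp [this, h0 x (fun h => hx h.2)]
    · intro a ha b hb h
      by_cases hav : a = v <;> by_cases hbv : b = v
      · rw [hav, hbv]
      · have := hlt b ⟨hbv, hb⟩
        simp [hav, hbv] at h
        omega
      · have := hlt a ⟨hav, ha⟩
        simp [hav, hbv] at h
        omega
      · simp only [Function.update_of_ne hav, Function.update_of_ne hbv] at h
        exact hinj a ⟨hav, ha⟩ b ⟨hbv, hb⟩ h
    · intro x hx
      by_cases hxv : x = v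
      · rw [hxv, Function.update_self]
        omega
      · have := hlt x ⟨hxv, hx⟩
        simp [hxv]
        omega
    · intro a ha b hb hab
      by_cases hbv : b = v
      · by_cases hav : a = v
        · simp [hav, hbv]
        · simpa [hav, hbv] using (hlt a ⟨hav, ha⟩).le
      · have hav : a ≠ v := fun h => hbv (hmax b hb (h ▸ hab))
        simpa [hav, hbv] using hmono a ⟨hav, ha⟩ b ⟨hbv, hb⟩ hab
    · intro a ha
      by_cases hav : a = v
      · simp [hav, hvT']
        omega
      · simpa [hav] using hto a ⟨hav, ha⟩⟩

instance (T T' : Finset V) : Finite (LinFun T T') := by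
  refine Finite.of_injective
    (fun f => fun x : {x // x ∈ T} => (⟨f.1 x, f.2.2.2.1 x x.2⟩ : Fin T.card)) ?_
  intro f g h
  refine Subtype.ext (funext fun x => ?_)
  by_cases hx : x ∈ T
  · exact Fin.mk.inj_iff.1 (congrFun h ⟨x, hx⟩)
  · rw [f.2.1 x hx, g.2.1 x hx]

/-- The maximal elements of `T`. -/
def maxElems (T : Finset V) : Finset V :=
  T.filter (fun v => ∀ w ∈ T, v ≤ w → w = v)

theorem mem_maxElems {T : Finset V} {v : V} :
    v ∈ maxElems T ↔ v ∈ T ∧ ∀ w ∈ T, v ≤ w → w = v :=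
  Finset.mem_filter

/-- Classifying linear extensions by their top element. -/
theorem sum_linExtTo_erase {T T' : Finset V} (hc : T'.card < T.card) :
    ∑ v ∈ maxElems T, linExtTo (T.erase v) T'
      = linExtTo T T' := by
  simp only [linExtTo_eq_card_linFun]
  rw [← Finset.sum_coe_sort, ← Nat.card_sigma]
  refine Nat.card_congr (Equiv.ofBijective (fun p => LinFun.insertTop hc
    (mem_maxElems.1 p.1.2).1 (mem_maxElems.1 p.1.2).2 p.2) ⟨?_, ?_⟩)
  · rintro ⟨⟨v, hv⟩, g⟩ ⟨⟨w, hw⟩, g'⟩ h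
    have h' : Function.update g.1 v (T.card - 1) = Function.update g'.1 w (T.card - 1) :=
      congrArg Subtype.val h
    have hvT := (mem_maxElems.1 hv).1
    have hwT := (mem_maxElems.1 hw).1
    obtain rfl : v = w := by
      by_contra hne
      have h1 := congrFun h' v
      have h2 := g'.2.2.2.1 v (Finset.mem_erase.2 ⟨hne, hvT⟩)
      rw [Function.update_self, Function.update_of_ne hne] at h1
      have h3 : g'.1 v < T.card - 1 := h2.trans_eq (Finset.card_erase_of_mem hwT)
      omega
    obtain rfl : g = g' := by
      refine Subtype.ext (funext fun x => ?_)
      by_cases hx : x = v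
      · rw [hx, g.2.1 v (Finset.notMem_erase v T), g'.2.1 v (Finset.notMem_erase v T)]
      · simpa [hx] using congrFun h' x
    rfl
  · intro f
    obtain ⟨v, hv, hfv⟩ := f.exists_eq (k := T.card - 1) (by omega)
    have hf := f.2
    obtain ⟨h0, hinj, hlt, hmono, hto⟩ := hf
    have hmax : ∀ w ∈ T, v ≤ w → w = v := by
      intro w hw hvw
      have h1 := hmono v hv w hw hvw
      have h2 := hlt w hw
      exact hinj w hw v hv (by omega)
    refine ⟨⟨⟨v, mem_maxElems.2 ⟨hv, hmax⟩⟩, ⟨Function.update f.1 v 0, ?_, ?_, ?_, ?_, ?_⟩⟩,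
      ?_⟩
    · intro x hx
      by_cases hxv : x = v
      · simp [hxv]
      · simpa [hxv] using h0 x (fun h => hx (Finset.mem_erase.2 ⟨hxv, h⟩))
    · intro a ha b hb h
      obtain ⟨hav, ha⟩ := Finset.mem_erase.1 ha
      obtain ⟨hbv, hb⟩ := Finset.mem_erase.1 hb
      simp only [Function.update_of_ne hav, Function.update_of_ne hbv] at h
      exact hinj a ha b hb h
    · intro x hx
      obtain ⟨hxv, hx⟩ := Finset.mem_erase.1 hx
      have h1 := hlt x hx
      have h2 : f.1 x ≠ f.1 v := fun h => hxv (hinj x hx v hv h)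
      rw [Function.update_of_ne hxv, Finset.card_erase_of_mem hv]
      omega
    · intro a ha b hb hab
      obtain ⟨hav, ha⟩ := Finset.mem_erase.1 ha
      obtain ⟨hbv, hb⟩ := Finset.mem_erase.1 hb
      simpa [hav, hbv] using hmono a ha b hb hab
    · intro a ha
      obtain ⟨hav, ha⟩ := Finset.mem_erase.1 ha
      simpa [hav] using hto a ha
    · apply Subtype.ext
      change Function.update (Function.update f.1 v 0) v (T.card - 1) = f.1
      rw [Function.update_idem, ← hfv, Function.update_eq_self]

theorem linExt_pos (T : Finset V) : 0 < linExt T := by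
  have e : Fin T.card ≃o LinearExtension {x // x ∈ T} :=
    @Fintype.orderIsoFinOfCardEq (LinearExtension {x // x ∈ T}) _
      (inferInstanceAs (Fintype {x // x ∈ T})) T.card (Fintype.card_coe T)
  have : Nonempty {φ : {x // x ∈ T} ≃ Fin T.card //
      ∀ a b : {x // x ∈ T}, (a : V) ≤ (b : V) → (φ a : ℕ) ≤ (φ b : ℕ)} :=
    ⟨⟨e.symm.toEquiv, fun a b h => e.symm.monotone (toLinearExtension.monotone h)⟩⟩
  exact Nat.card_pos

theorem linExtTo_self (T : Finset V) : linExtTo T T = linExt T :=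
  Nat.card_congr (Equiv.subtypeEquivRight fun φ =>
    ⟨fun h => h.1, fun h => ⟨h, fun a => by simp⟩⟩)

theorem fE_self (T : RSub V) : fE T T = 1 := by
  have : (linExt T.1 : ℝ) ≠ 0 := by exact_mod_cast (linExt_pos T.1).ne'
  simp [fE, linExtTo_self, this]

theorem fE_eq_zero_of_card_lt {T' T : RSub V} (h : T.1.card < T'.1.card) : fE T' T = 0 := by
  simp [fE, Nat.choose_eq_zero_of_lt h]

theorem fE_eq_zero_of_not_subset {T' T : RSub V} (h : ¬ T'.1 ⊆ T.1) : fE T' T = 0 := by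
  rcases lt_or_ge T.1.card T'.1.card with hc | hc
  · exact fE_eq_zero_of_card_lt hc
  · have : IsEmpty (LinFun T.1 T'.1) := ⟨fun f => h (f.subset hc)⟩
    simp [fE, linExtTo_eq_card_linFun]

/-- Removing a maximal element from a rooted subtree with at least two elements. -/
def RSub.eraseMax (T : RSub V) (hT : 2 ≤ T.1.card) {v : V}
    (hv : v ∈ maxElems T.1) : RSub V :=
  ⟨T.1.erase v, by
    obtain ⟨hvT, hmax⟩ := mem_maxElems.1 hv
    refine ⟨?_, ?_⟩
    · rw [← Finset.card_pos, Finset.card_erase_of_mem hvT]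
      omega
    · intro a b hab hb
      obtain ⟨hbv, hb⟩ := Finset.mem_erase.1 hb
      exact Finset.mem_erase.2
        ⟨fun h => hbv (hmax b hb (h ▸ hab)), T.2.2 hab hb⟩⟩

theorem sum_Kfire_mul [Fintype V] (T : RSub V) (hT : 2 ≤ T.1.card) (F G : Finset V → ℝ)
    (hF : ∀ S, F S = G S / (linExt S : ℝ)) :
    ∑ S : RSub V, Kfire T S * F S.1
      = ((Fintype.card V : ℝ) - (T.1.card : ℝ)) / (Fintype.card V : ℝ) * F T.1
        + (T.1.card : ℝ) / (Fintype.card V : ℝ) / (linExt T.1 : ℝ)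
          * ∑ v ∈ maxElems T.1, G (T.1.erase v) := by
  have hpt : ∀ S : RSub V, Kfire T S * F S.1
      = (if S = T then ((Fintype.card V : ℝ) - (T.1.card : ℝ)) / (Fintype.card V : ℝ) * F T.1
          else 0)
        + ∑ v ∈ maxElems T.1,
          if S.1 = T.1.erase v then
            (T.1.card : ℝ) / (Fintype.card V : ℝ) / (linExt T.1 : ℝ) * G (T.1.erase v)
          else 0 := by
    intro S
    by_cases hST : S = T
    · subst hST
      have : ∑ v ∈ maxElems S.1,
          (if S.1 = S.1.erase v then
            (S.1.card : ℝ) / (Fintype.card V : ℝ) / (linExt S.1 : ℝ) * G (S.1.erase v)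
          else 0) = 0 := by
        refine Finset.sum_eq_zero fun v hv => if_neg fun h => ?_
        exact Finset.notMem_erase v S.1 (h ▸ (mem_maxElems.1 hv).1)
      rw [this, Kfire, if_pos hT, if_pos rfl, if_pos rfl, add_zero]
    · by_cases hex : ∃ v ∈ T.1, (∀ w ∈ T.1, v ≤ w → w = v) ∧ S.1 = T.1.erase v
      · rw [Kfire, if_pos hT, if_neg hST, if_pos hex, if_neg hST, zero_add]
        obtain ⟨v, hv, hmax, hS⟩ := hex
        rw [Finset.sum_eq_single_of_mem v (mem_maxElems.2 ⟨hv, hmax⟩), if_pos hS, hF, hS]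
        · have : (linExt (T.1.erase v) : ℝ) ≠ 0 := by exact_mod_cast (linExt_pos _).ne'
          field_simp
        · intro w hw hwv
          refine if_neg fun h => hwv ?_
          rw [hS] at h
          by_contra
          exact Finset.notMem_erase w T.1
            (h ▸ Finset.mem_erase.2 ⟨hwv, (mem_maxElems.1 hw).1⟩)
      · rw [Kfire, if_pos hT, if_neg hST, if_neg hex, if_neg hST, zero_mul, zero_add]
        refine (Finset.sum_eq_zero fun v hv => if_neg fun h => hex ?_).symm
        exact ⟨v, (mem_maxElems.1 hv).1, (mem_maxElems.1 hv).2, h⟩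
  rw [Finset.sum_congr rfl fun S _ => hpt S, Finset.sum_add_distrib, Finset.sum_comm,
    Finset.sum_ite_eq' Finset.univ T, if_pos (Finset.mem_univ _), Finset.mul_sum]
  congr 1
  refine Finset.sum_congr rfl fun v hv => ?_
  rw [Finset.sum_eq_single_of_mem (T.eraseMax hT hv) (Finset.mem_univ _)]
  · exact if_pos rfl
  · exact fun S _ hS => if_neg fun h => hS (Subtype.ext h)

theorem sum_Kfire_mul_fE [Fintype V] (T' : RSub V) (hT' : 2 ≤ T'.1.card) (T : RSub V) :
    ∑ S : RSub V, Kfire T S * fE T' S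
      = ((Fintype.card V : ℝ) - (T'.1.card : ℝ)) / (Fintype.card V : ℝ) * fE T' T := by
  by_cases hT : 2 ≤ T.1.card
  · rw [show (∑ S : RSub V, Kfire T S * fE T' S) = _ from sum_Kfire_mul T hT
      (fun S => (Nat.choose S.card T'.1.card : ℝ) * (linExtTo S T'.1 : ℝ) / (linExt S : ℝ))
      (fun S => (Nat.choose S.card T'.1.card : ℝ) * (linExtTo S T'.1 : ℝ)) fun S => rfl]
    have hsum : ∑ v ∈ maxElems T.1,
          ((T.1.erase v).card.choose T'.1.card : ℝ) * (linExtTo (T.1.erase v) T'.1 : ℝ)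
        = ((T.1.card - 1).choose T'.1.card : ℝ) * (linExtTo T.1 T'.1 : ℝ) := by
      rcases lt_or_ge T'.1.card T.1.card with hc | hc
      · rw [← sum_linExtTo_erase hc, Nat.cast_sum, Finset.mul_sum]
        refine Finset.sum_congr rfl fun v hv => ?_
        rw [Finset.card_erase_of_mem (mem_maxElems.1 hv).1]
      · have h0 : (T.1.card - 1).choose T'.1.card = 0 := Nat.choose_eq_zero_of_lt (by omega)
        rw [h0, Nat.cast_zero, zero_mul]
        refine Finset.sum_eq_zero fun v hv => ?_
        rw [Finset.card_erase_of_mem (mem_maxElems.1 hv).1, h0, Nat.cast_zero, zero_mul]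
    have hchoose : (T.1.card : ℝ) * ((T.1.card - 1).choose T'.1.card : ℝ)
        = ((T.1.card : ℝ) - (T'.1.card : ℝ)) * (T.1.card.choose T'.1.card : ℝ) := by
      obtain ⟨m, hm⟩ : ∃ m, T.1.card = m + 1 := ⟨T.1.card - 1, by omega⟩
      rw [hm, Nat.add_sub_cancel]
      rcases le_or_gt T'.1.card (m + 1) with hc | hc
      · have h := Nat.choose_mul_succ_eq m T'.1.card
        rw [← Nat.cast_sub hc]
        exact_mod_cast (mul_comm _ _).trans (h.trans (mul_comm _ _))
      · rw [Nat.choose_eq_zero_of_lt hc, Nat.choose_eq_zero_of_lt (by omega : m < T'.1.card)]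
        simp
    rw [hsum]
    simp only [fE]
    linear_combination
      ((linExtTo T.1 T'.1 : ℝ) / (Fintype.card V : ℝ) / (linExt T.1 : ℝ)) * hchoose
  · rw [fE_eq_zero_of_card_lt (by omega : T.1.card < T'.1.card), mul_zero]
    refine Finset.sum_eq_zero fun S _ => ?_
    by_cases hST : S = T
    · rw [hST, fE_eq_zero_of_card_lt (by omega : T.1.card < T'.1.card), mul_zero]
    · rw [Kfire, if_neg hT, if_neg hST, zero_mul]

theorem RSub.subset_of_card_lt_two [OrderBot V] {T' : RSub V} (h : ¬ 2 ≤ T'.1.card)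
    (T : RSub V) : T'.1 ⊆ T.1 := by
  have hbot : ∀ S : RSub V, ⊥ ∈ S.1 := fun S =>
    let ⟨_, hx⟩ := S.2.1
    S.2.2 bot_le hx
  intro x hx
  rw [Finset.card_le_one.1 (by omega : T'.1.card ≤ 1) x hx ⊥ (hbot T')]
  exact hbot T

end LinearExtensions

/-- A finite family of functions that is unitriangular with respect to a partial order on
the index type is linearly independent. -/
theorem linearIndependent_of_unitriangular {ι R : Type*} [Fintype ι] [PartialOrder ι] [Ring R]
    (g : ι → ι → R) (hdiag : ∀ i, g i i = 1) (hzero : ∀ i j, ¬ i ≤ j → g i j = 0) :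
    LinearIndependent R g := by
  rw [Fintype.linearIndependent_iff]
  intro c hc i
  induction i using WellFoundedLT.induction with
  | ind i ih =>
    have h := congrFun hc i
    rw [Finset.sum_apply, Finset.sum_eq_single_of_mem i (Finset.mem_univ i)] at h
    · simpa [hdiag] using h
    · intro j _ hj
      by_cases hji : j ≤ i
      · simp [ih j (lt_of_le_of_ne hji hj)]
      · simp [hzero j i hji]

/-- **Right eigenfunctions of the single-model firing chain.**  For every rooted subtree
`T'` with `|T'| ≥ 2`, the function `f_{T'}` is a right eigenfunction of `Kfire` with
eigenvalue `(n₀ - |T'|)/n₀`, and these functions, together with the constant function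
`1`, form a basis of the space of all real-valued functions on rooted subtrees. -/
theorem firing_chain_eigenbasis (V : Type) [Fintype V] [PartialOrder V] [OrderBot V]
    (htree : ∀ v a b : V, a ≤ v → b ≤ v → a ≤ b ∨ b ≤ a) :
    (∀ T' : RSub V, 2 ≤ T'.1.card → ∀ T : RSub V,
        ∑ T'' : RSub V, Kfire T T'' * fE T' T''
          = (((Fintype.card V : ℝ) - (T'.1.card : ℝ)) / (Fintype.card V : ℝ)) * fE T' T) ∧
    LinearIndependent ℝ (fun T' : RSub V =>
        if 2 ≤ T'.1.card then fE T' else fun _ : RSub V => (1 : ℝ)) ∧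
    Submodule.span ℝ (Set.range (fun T' : RSub V =>
        if 2 ≤ T'.1.card then fE T' else fun _ : RSub V => (1 : ℝ))) = ⊤ := by
  have hli : LinearIndependent ℝ (fun T' : RSub V =>
      if 2 ≤ T'.1.card then fE T' else fun _ : RSub V => (1 : ℝ)) := by
    refine linearIndependent_of_unitriangular _ (fun T => ?_) (fun T' T h => ?_)
    · split_ifs
      · exact fE_self T
      · rfl
    · split_ifs with hT'
      · exact fE_eq_zero_of_not_subset h
      · exact absurd (RSub.subset_of_card_lt_two hT' T) h
  exact ⟨sum_Kfire_mul_fE, hli, hli.span_eq_top_of_card_eq_finrank' (by simp)⟩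

end
end

section
/- The characteristic polynomial of the transition matrix K of the single-model firing chain equals (X − 1) · ∏_{T'} (X − (n0 − |T'|)/n0), the product running over all rooted subtrees T' of T0 with |T'| ≥ 2. Equivalently, the eigenvalues of K are 1 and the numbers (n0 − n')/n0 for 2 ≤ n' ≤ n0, the latter occurring with algebraic multiplicity equal to the number of rooted subtrees of T0 with exactly n' elements. -/
open scoped Classical

noncomputable section

/-- If the nonzero entries of a square matrix respect a partial order on its indices, its
characteristic polynomial is determined by its diagonal. -/
theorem charpoly_eq_prod_diag_of_partialOrder {ι R : Type} [PartialOrder ι] [Fintype ι]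
    [DecidableEq ι] [CommRing R] (M : Matrix ι ι R) (h : ∀ i j, M i j ≠ 0 → j ≤ i) :
    M.charpoly = ∏ i, (Polynomial.X - Polynomial.C (M i i)) := by
  let e : ι ≃ LinearExtension ι := Equiv.refl ι
  let _ : Fintype (LinearExtension ι) := Fintype.ofEquiv ι e
  have hup : (Matrix.reindex e e M.transpose).IsUpperTriangular := by
    intro i j hij
    by_contra hne
    exact absurd (toLinearExtension.monotone (h (e.symm j) (e.symm i) hne)) (not_le.mpr hij)
  rw [← Matrix.charpoly_transpose, ← Matrix.charpoly_reindex e]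
  convert Matrix.charpoly_of_isUpperTriangular _ hup using 1
  exact Fintype.prod_equiv e _ _ fun _ => rfl

/-- The firing chain only moves to smaller rooted subtrees. -/
theorem le_of_Kfire_ne_zero {V : Type} [Fintype V] [PartialOrder V] (T T' : RSub V)
    (h : Kfire T T' ≠ 0) : T' ≤ T := by
  unfold Kfire at h
  split_ifs at h with h1 h2 h3 h4
  · exact h2.le
  · obtain ⟨v, -, -, hT'⟩ := h3
    exact Subtype.coe_le_coe.mp (hT'.trans_le (Finset.erase_subset v T.1))
  · exact absurd rfl h
  · exact h4.le
  · exact absurd rfl h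

/-- The singleton root is the only rooted subtree with fewer than two elements. -/
theorem card_lt_two_iff_eq_singleton_bot {V : Type} [PartialOrder V] [OrderBot V]
    (T : RSub V) : T.1.card < 2 ↔ T.1 = {⊥} := by
  refine ⟨fun h => ?_, fun h => by simp [h]⟩
  obtain ⟨x, hx⟩ := T.2.1
  have hbot : ⊥ ∈ T.1 := T.2.2 bot_le hx
  exact (Finset.eq_of_subset_of_card_le (Finset.singleton_subset_iff.mpr hbot)
    (by simpa using Nat.le_of_lt_succ h)).symm

/-- **Characteristic polynomial of the single-model firing chain.**  The characteristic
polynomial of `Kfire` equals `(X - 1) ⬝ ∏_{T'} (X - (n₀ - |T'|)/n₀)`, the product running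
over all rooted subtrees `T'` with at least two elements.  Equivalently, the eigenvalues
are `1` and `(n₀ - n')/n₀` for `2 ≤ n' ≤ n₀`, the latter with algebraic multiplicity the
number of rooted subtrees with exactly `n'` elements. -/
theorem firing_chain_charpoly (V : Type) [Fintype V] [PartialOrder V] [OrderBot V]
    (htree : ∀ v a b : V, a ≤ v → b ≤ v → a ≤ b ∨ b ≤ a) :
    (KfireM V).charpoly
      = (Polynomial.X - Polynomial.C (1 : ℝ)) *
        ∏ T' ∈ Finset.univ.filter (fun T' : RSub V => 2 ≤ T'.1.card),
          (Polynomial.X - Polynomial.C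
            (((Fintype.card V : ℝ) - (T'.1.card : ℝ)) / (Fintype.card V : ℝ))) := by
  have hprod := charpoly_eq_prod_diag_of_partialOrder (KfireM V)
    fun T T' h => le_of_Kfire_ne_zero T T' h
  let root : RSub V := ⟨{⊥}, Finset.singleton_nonempty _, fun a b hab hb => by
    rw [Finset.mem_singleton] at hb ⊢
    exact le_bot_iff.mp (hb ▸ hab)⟩
  have hroot : Finset.univ.filter (fun T' : RSub V => ¬ 2 ≤ T'.1.card) = {root} := by
    ext T
    rw [Finset.mem_filter, not_le, card_lt_two_iff_eq_singleton_bot]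
    simp [root, Subtype.ext_iff]
  rw [hprod, ← Finset.prod_filter_mul_prod_filter_not Finset.univ
    (fun T' : RSub V => 2 ≤ T'.1.card), hroot, Finset.prod_singleton, mul_comm]
  congr 1
  · simp [KfireM, Kfire, root]
  · refine Finset.prod_congr rfl fun T hT => ?_
    simp [KfireM, Kfire, (Finset.mem_filter.mp hT).2]

end
end
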